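/- Let r > 0 and let D(0,r) = { z ∈ ℂ : |z| < r }. Let 𝒳 be a complex vector subspace of the space of functions from D(0,r) to ℂ, equipped with a topology such that: (1) for each w ∈ D(0,r), the evaluation map f ↦ f(w) from 𝒳 to ℂ is continuous; (2) 𝒳 contains the restrictions to D(0,r) of all complex polynomials, and these form a dense subset of 𝒳. Let 𝒴 = { (z − λ)ⁿ : n ≥ 0, λ ∈ ℂ, |λ| ≥ r } (viewed as functions on D(0,r)). If F : 𝒳 → ℂ is a continuous linear functional with F(1) = 1 and F(g) ≠ 0 for all g ∈ 𝒴, then there exists w ∈ D(0,r) such that F(f) = f(w) for all f ∈ 𝒳. -/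

import Mathlib

open Filter Topology

/-- A multiset of cardinality `n` is the multiset of values of a function on `Fin n`. -/
theorem exists_fin_map_eq {α : Type*} {n : ℕ} {s : Multiset α} (hs : Multiset.card s = n) :
    ∃ x : Fin n → α, Finset.univ.val.map x = s := by
  subst hs
  obtain ⟨l, rfl⟩ := Quot.exists_rep s
  exact ⟨l.get, (Fin.univ_val_map l.get).trans (congrArg _ (List.ofFn_get l))⟩

/-- If the Appell polynomial `∑ (n.choose k) a k (-z) ^ (n - k)` has no zero with `r ≤ ‖z‖`, then
the numbers `(n.choose k) a k` are the elementary symmetric functions of `n` points of norm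
less than `r`. -/
theorem exists_roots_esymm_eq (a : ℕ → ℂ) (ha : a 0 = 1) (r : ℝ) (n : ℕ)
    (h : ∀ z : ℂ, r ≤ ‖z‖ →
      ∑ k ∈ Finset.range (n + 1), (n.choose k : ℂ) * a k * (-z) ^ (n - k) ≠ 0) :
    ∃ x : Fin n → ℂ, (∀ i, ‖x i‖ < r) ∧
      ∀ k, MvPolynomial.aeval x (MvPolynomial.esymm (Fin n) ℂ k) = n.choose k * a k := by
  classical
  set P : Polynomial ℂ := ∑ j ∈ Finset.range (n + 1),
    Polynomial.C ((n.choose j : ℂ) * (-1) ^ (n - j) * a (n - j)) * Polynomial.X ^ j with hP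
  have hcoeff : ∀ j ≤ n, P.coeff j = (n.choose j : ℂ) * (-1) ^ (n - j) * a (n - j) := by
    intro j hj
    simp only [hP, Polynomial.finsetSum_coeff, Polynomial.coeff_C_mul, Polynomial.coeff_X_pow]
    simpa using fun hlt => absurd hlt hj.not_gt
  have hdeg : P.natDegree = n := by
    apply Polynomial.natDegree_eq_of_le_of_coeff_ne_zero
    · refine Polynomial.natDegree_sum_le_of_forall_le _ _ fun j hj => ?_
      exact (Polynomial.natDegree_C_mul_X_pow_le _ _).trans (by simpa [Nat.lt_succ_iff] using hj)
    · simp [hcoeff, ha]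
  have hlead : P.leadingCoeff = 1 := by
    rw [Polynomial.leadingCoeff, hdeg]; simp [hcoeff, ha]
  have heval : ∀ z, P.eval z =
      (-1) ^ n * ∑ k ∈ Finset.range (n + 1), (n.choose k : ℂ) * a k * (-z) ^ (n - k) := by
    intro z
    rw [hP, Polynomial.eval_finsetSum, ← Finset.sum_range_reflect, Finset.mul_sum]
    refine Finset.sum_congr rfl fun k hk => ?_
    have hk' : k ≤ n := by simpa [Nat.lt_succ_iff] using hk
    obtain ⟨m, rfl⟩ := Nat.exists_eq_add_of_le hk'
    have e1 : k + m + 1 - 1 - k = m := by omega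
    have e2 : k + m - m = k := by omega
    have e3 : k + m - k = m := by omega
    simp only [e1, e2, e3, Polynomial.eval_mul, Polynomial.eval_C, Polynomial.eval_pow,
      Polynomial.eval_X]
    rw [show (k + m).choose m = (k + m).choose k from (Nat.choose_symm_add).symm, neg_pow z,
      pow_add]
    have : ((-1 : ℂ) ^ m) * (-1) ^ m = 1 := by rw [← mul_pow]; simp
    linear_combination (-((k + m).choose k : ℂ) * (-1) ^ k * a k * z ^ m) * this
  have hP0 : P ≠ 0 := fun h0 => by simp [h0] at hlead
  have hcard : Multiset.card P.roots = n := by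
    rw [← hdeg]; exact (Polynomial.splits_iff_card_roots.mp (IsAlgClosed.splits P))
  obtain ⟨x, hx⟩ := exists_fin_map_eq hcard
  refine ⟨x, fun i => ?_, fun k => ?_⟩
  · by_contra! hi
    have hr : x i ∈ P.roots := hx ▸ Multiset.mem_map_of_mem x (Finset.mem_univ i)
    have := (Polynomial.mem_roots hP0).1 hr
    rw [Polynomial.IsRoot, heval] at this
    exact h _ hi (by simpa using this)
  · rw [MvPolynomial.aeval_esymm_eq_multiset_esymm, hx]
    rcases le_or_gt k n with hk | hk
    · have := Polynomial.coeff_eq_esymm_roots_of_card (p := P) (by rw [hcard, hdeg])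
        (k := n - k) (by rw [hdeg]; omega)
      rw [hcoeff _ (by omega), hlead, hdeg, Nat.sub_sub_self hk, Nat.choose_symm hk] at this
      have h1 : ((-1 : ℂ) ^ k) * (-1) ^ k = 1 := by rw [← mul_pow]; simp
      linear_combination (-(-1) ^ k) * this + (n.choose k * a k - P.roots.esymm k) * h1
    · rw [Nat.choose_eq_zero_of_lt hk, Multiset.esymm, Multiset.powersetCard_eq_empty _ (by omega)]
      simp

theorem tendsto_choose_div_pow (k : ℕ) :
    Tendsto (fun n : ℕ => (n.choose k : ℂ) / (n : ℂ) ^ k) atTop (𝓝 (1 / (k.factorial : ℂ))) := by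
  have hone : Tendsto (fun n : ℕ => (n : ℝ) * (1 / n)) atTop (𝓝 1) := by
    refine tendsto_const_nhds.congr' ?_
    filter_upwards [eventually_ge_atTop 1] with n hn
    have : (n : ℝ) ≠ 0 := by exact_mod_cast (by omega : n ≠ 0)
    field_simp
  have := (Complex.continuous_ofReal.tendsto _).comp
    (ProbabilityTheory.tendsto_choose_mul_pow_atTop k hone)
  simpa [Function.comp_def, div_eq_mul_inv] using this

/-- If no Appell polynomial `∑ (n.choose k) a k (-z) ^ (n - k)` has a zero with `r ≤ ‖z‖`, then `a`
is a geometric sequence. The proof divides Newton's identity for the zeros by `n ^ k` and lets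
`n → ∞`; all the power sums of degree at least two vanish in the limit. -/
theorem eq_pow_of_forall_sum_ne_zero (a : ℕ → ℂ) (ha : a 0 = 1) (r : ℝ)
    (h : ∀ n : ℕ, ∀ z : ℂ, r ≤ ‖z‖ →
      ∑ k ∈ Finset.range (n + 1), (n.choose k : ℂ) * a k * (-z) ^ (n - k) ≠ 0) (k : ℕ) :
    a k = a 1 ^ k := by
  choose x hxr hx using fun n => exists_roots_esymm_eq a ha r n (h n)
  induction k with
  | zero => simp [ha]
  | succ k ih =>
  have hpsum : ∀ n j, ‖MvPolynomial.aeval (x n) (MvPolynomial.psum (Fin n) ℂ j)‖ ≤ n * r ^ j := by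
    intro n j
    simp only [MvPolynomial.psum, map_sum, map_pow, MvPolynomial.aeval_X]
    refine (norm_sum_le _ _).trans ?_
    refine (Finset.sum_le_card_nsmul _ _ (r ^ j) fun i _ => ?_).trans (by simp)
    rw [norm_pow]
    exact pow_le_pow_left₀ (norm_nonneg _) (hxr n i).le j
  have hpsum1 : ∀ n, MvPolynomial.aeval (x n) (MvPolynomial.psum (Fin n) ℂ 1) = n * a 1 := by
    intro n
    have := hx n 1
    simpa using this
  have hesymm_lim : ∀ i, Tendsto (fun n => MvPolynomial.aeval (x n)
      (MvPolynomial.esymm (Fin n) ℂ i) / (n : ℂ) ^ i) atTop (𝓝 (a i / i.factorial)) := by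
    intro i
    simp only [hx]
    convert (tendsto_choose_div_pow i).mul_const (a i) using 2 <;> ring
  have hpsum_lim : ∀ j, 2 ≤ j → Tendsto (fun n => MvPolynomial.aeval (x n)
      (MvPolynomial.psum (Fin n) ℂ j) / (n : ℂ) ^ j) atTop (𝓝 0) := by
    intro j hj
    have hlim : Tendsto (fun n : ℕ => |r| ^ j * (1 / (n : ℝ))) atTop (𝓝 0) := by
      simpa using tendsto_one_div_atTop_nhds_zero_nat.const_mul (|r| ^ j)
    refine squeeze_zero_norm' ?_ hlim
    filter_upwards [eventually_ge_atTop 1] with n hn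
    have hn' : (1 : ℝ) ≤ n := by exact_mod_cast hn
    have hrj : r ^ j ≤ |r| ^ j := (le_abs_self _).trans (abs_pow r j).le
    rw [norm_div, norm_pow, Complex.norm_natCast, div_le_iff₀ (by positivity)]
    refine (hpsum n j).trans ?_
    obtain ⟨m, rfl⟩ := Nat.exists_eq_add_of_le hj
    have : (n : ℝ) ≤ 1 / n * n ^ (2 + m) := by
      rw [show 1 / (n : ℝ) * n ^ (2 + m) = n * n ^ m by field_simp; ring]
      exact le_mul_of_one_le_right (by positivity) (one_le_pow₀ hn')
    calc (n : ℝ) * r ^ (2 + m) ≤ n * |r| ^ (2 + m) := by gcongr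
      _ = |r| ^ (2 + m) * n := by ring
      _ ≤ |r| ^ (2 + m) * (1 / n * n ^ (2 + m)) := by gcongr
      _ = _ := by ring
  have hpsum1_lim : Tendsto (fun n => MvPolynomial.aeval (x n)
      (MvPolynomial.psum (Fin n) ℂ 1) / (n : ℂ) ^ 1) atTop (𝓝 (a 1)) := by
    refine tendsto_const_nhds.congr' ?_
    filter_upwards [eventually_ge_atTop 1] with n hn
    have : (n : ℂ) ≠ 0 := by exact_mod_cast (by omega : n ≠ 0)
    rw [hpsum1]; field_simp
  have newton : ∀ n, ((k + 1 : ℕ) : ℂ) * (MvPolynomial.aeval (x n)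
      (MvPolynomial.esymm (Fin n) ℂ (k + 1)) / (n : ℂ) ^ (k + 1)) =
      (-1) ^ (k + 2) * ∑ p ∈ Finset.HasAntidiagonal.antidiagonal (k + 1) with p.1 < k + 1, (-1) ^ p.1 *
        (MvPolynomial.aeval (x n) (MvPolynomial.esymm (Fin n) ℂ p.1) / (n : ℂ) ^ p.1) *
        (MvPolynomial.aeval (x n) (MvPolynomial.psum (Fin n) ℂ p.2) / (n : ℂ) ^ p.2) := by
    intro n
    have := congrArg (MvPolynomial.aeval (x n)) (MvPolynomial.mul_esymm_eq_sum (Fin n) ℂ (k + 1))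
    simp only [map_mul, map_sum, map_pow, map_neg, map_one, map_natCast] at this
    rw [← mul_div_assoc, this, mul_div_assoc, Finset.sum_div]
    congr 1
    refine Finset.sum_congr rfl fun p hp => ?_
    have hp : p.1 + p.2 = k + 1 := by simpa using (Finset.mem_filter.1 hp).1
    rw [← hp, pow_add, mul_assoc, mul_div_assoc, mul_assoc, div_mul_div_comm]
  have hL := (hesymm_lim (k + 1)).const_mul ((k + 1 : ℕ) : ℂ)
  have hR : Tendsto (fun n => (-1 : ℂ) ^ (k + 2) *
      ∑ p ∈ Finset.HasAntidiagonal.antidiagonal (k + 1) with p.1 < k + 1, (-1) ^ p.1 *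
        (MvPolynomial.aeval (x n) (MvPolynomial.esymm (Fin n) ℂ p.1) / (n : ℂ) ^ p.1) *
        (MvPolynomial.aeval (x n) (MvPolynomial.psum (Fin n) ℂ p.2) / (n : ℂ) ^ p.2)) atTop
      (𝓝 ((-1 : ℂ) ^ (k + 2) * ∑ p ∈ Finset.HasAntidiagonal.antidiagonal (k + 1) with p.1 < k + 1,
        (-1) ^ p.1 * (a p.1 / p.1.factorial) * (if p.2 = 1 then a 1 else 0))) := by
    refine (tendsto_finsetSum _ fun p hp => ?_).const_mul _
    refine ((hesymm_lim p.1).const_mul _).mul ?_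
    have hp1 := (Finset.mem_filter.1 hp).2
    have hp2 : p.1 + p.2 = k + 1 := by simpa using (Finset.mem_filter.1 hp).1
    split_ifs with h1
    · rw [h1]; exact hpsum1_lim
    · exact hpsum_lim _ (by omega)
  have key := tendsto_nhds_unique (hL.congr newton) hR
  rw [Finset.sum_eq_single (k, 1)] at key
  · have hk0 : (k.factorial : ℂ) ≠ 0 := by exact_mod_cast k.factorial_ne_zero
    have hk1 : (k : ℂ) + 1 ≠ 0 := by exact_mod_cast k.succ_ne_zero
    have h1 : ((-1 : ℂ) ^ k) * (-1) ^ k = 1 := by rw [← mul_pow]; simp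
    rw [Nat.factorial_succ] at key
    push_cast at key
    rw [pow_add] at key
    field_simp at key
    rw [pow_succ, ← ih]
    linear_combination key + a k * a 1 * h1
  · intro p hp hne
    have hp2 : p.1 + p.2 = k + 1 := by simpa using (Finset.mem_filter.1 hp).1
    rw [if_neg, mul_zero]
    intro h1
    exact hne (Prod.ext (by simp; omega) h1)
  · intro hn
    exact absurd (by simp) hn

/-- GKZ-type theorem on a topologized space `𝒳` of functions on `D(0,r)` containing the
polynomials as a dense subset, with continuous point evaluations: a continuous linear
functional `F` with `F(1) = 1` not vanishing on any `(z - λ)ⁿ` with `|λ| ≥ r` is a point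
evaluation at some `w ∈ D(0,r)`. -/
theorem stmt_7 (r : ℝ) (hr : 0 < r)
    (𝒳 : Submodule ℂ (↥(Metric.ball (0 : ℂ) r) → ℂ))
    [TopologicalSpace ↥𝒳]
    (heval : ∀ w : ↥(Metric.ball (0 : ℂ) r),
      Continuous fun f : ↥𝒳 => f.val w)
    (hpoly_mem : ∀ p : Polynomial ℂ,
      (fun w : ↥(Metric.ball (0 : ℂ) r) => p.eval (w : ℂ)) ∈ 𝒳)
    (hpoly_dense : Dense {f : ↥𝒳 | ∃ p : Polynomial ℂ,
      ∀ w : ↥(Metric.ball (0 : ℂ) r), f.val w = p.eval (w : ℂ)})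
    (F : ↥𝒳 →ₗ[ℂ] ℂ) (hFcont : Continuous F)
    (hF1 : ∀ f : ↥𝒳, (∀ w, f.val w = 1) → F f = 1)
    (hFY : ∀ f : ↥𝒳, (∃ (nn : ℕ) (lam : ℂ), r ≤ ‖lam‖ ∧
      ∀ w : ↥(Metric.ball (0 : ℂ) r), f.val w = ((w : ℂ) - lam) ^ nn) → F f ≠ 0) :
    ∃ w : ↥(Metric.ball (0 : ℂ) r), ∀ f : ↥𝒳, F f = f.val w := by
  let ι : Polynomial ℂ →ₗ[ℂ] ↥𝒳 :=
    { toFun := fun p => ⟨fun w => p.eval (w : ℂ), hpoly_mem p⟩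
      map_add' := fun p q => by ext w; simp
      map_smul' := fun c p => by ext w; simp }
  let L : Polynomial ℂ →ₗ[ℂ] ℂ := F ∘ₗ ι
  let a : ℕ → ℂ := fun k => L (Polynomial.X ^ k)
  have ha0 : a 0 = 1 := hF1 _ fun w => by simp [ι]
  have hsum : ∀ n : ℕ, ∀ z : ℂ, r ≤ ‖z‖ →
      ∑ k ∈ Finset.range (n + 1), (n.choose k : ℂ) * a k * (-z) ^ (n - k) ≠ 0 := by
    intro n z hz
    have hL : L ((Polynomial.X + Polynomial.C (-z)) ^ n) =
        ∑ k ∈ Finset.range (n + 1), (n.choose k : ℂ) * a k * (-z) ^ (n - k) := by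
      rw [add_pow, map_sum]
      refine Finset.sum_congr rfl fun k _ => ?_
      have : (Polynomial.X ^ k * Polynomial.C (-z) ^ (n - k) * (n.choose k : Polynomial ℂ)) =
          ((n.choose k : ℂ) * (-z) ^ (n - k)) • (Polynomial.X ^ k : Polynomial ℂ) := by
        rw [Polynomial.smul_eq_C_mul, Polynomial.C_mul, Polynomial.C_pow, Polynomial.C_eq_natCast]
        ring
      rw [this, map_smul, smul_eq_mul]
      ring
    rw [← hL]
    exact hFY _ ⟨n, z, hz, fun w => by simp [ι, sub_eq_add_neg]⟩
  have hpow := eq_pow_of_forall_sum_ne_zero a ha0 r hsum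
  have hw : ‖a 1‖ < r := by
    by_contra! hle
    exact hsum 1 (a 1) hle (by simp [Finset.sum_range_succ, ha0])
  refine ⟨⟨a 1, by simpa using hw⟩, fun f => ?_⟩
  have hLp : ∀ p : Polynomial ℂ, L p = p.eval (a 1) := by
    have : L = Polynomial.leval (a 1) := by
      ext k
      simpa [a, Polynomial.X_pow_eq_monomial] using hpow k
    intro p
    rw [this]; rfl
  refine congrFun (hFcont.ext_on hpoly_dense (heval ⟨a 1, by simpa using hw⟩) ?_) f
  rintro g ⟨p, hp⟩
  have hg : g = ι p := Subtype.ext (funext hp)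
  rw [hg]
  exact hLp p
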